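/- Let k, n ∈ ℕ with 2^{k+1} ≤ n and let λ ⊢_o n. Then f_k(f_k(λ)) = f_{k+1}(λ) if and only if R_k^k(λ) = R_k^{k+1}(λ) and this common component μ satisfies f_0(f_0(μ)) = f_1(μ) (i.e. μ ∈ 𝒢_0). -/

import Mathlib

namespace OddSym

open scoped Classical

/-- Remove one box from a row of size `p` (as multisets of parts). -/
def removeBox (lam : Multiset ℕ) (p : ℕ) : Multiset ℕ :=
  if p ≤ 1 then lam.erase p else (p - 1) ::ₘ lam.erase p

lemma removeBox_sum_lt {lam : Multiset ℕ} {p : ℕ} (hp : p ∈ lam) (h0 : 0 < p) :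
    (removeBox lam p).sum < lam.sum := by
  have h : p + (lam.erase p).sum = lam.sum := by
    conv_rhs => rw [← Multiset.cons_erase hp]
    simp [Multiset.sum_cons]
  unfold removeBox
  split
  · omega
  · simp only [Multiset.sum_cons]
    omega

/-- The number of standard Young tableaux of shape `lam`
(equivalently, the degree of the irreducible character of the symmetric
group labelled by `lam`), defined via the branching rule. -/
def degSYT (lam : Multiset ℕ) : ℕ :=
  if _h : lam = 0 then 1
  else ∑ p ∈ (lam.toFinset.filter (fun p => 0 < p)).attach, degSYT (removeBox lam p.1)
termination_by lam.sum
decreasing_by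
  have hp := p.2
  simp only [Finset.mem_filter, Multiset.mem_toFinset] at hp
  exact removeBox_sum_lt hp.1 hp.2

/-- `lam` is an odd partition: all parts positive and the number of standard
Young tableaux of shape `lam` (= the character degree) is odd. -/
def OddP (lam : Multiset ℕ) : Prop :=
  (∀ x ∈ lam, 0 < x) ∧ Odd (degSYT lam)

/-- The parts of `lam` sorted in weakly decreasing order. -/
def descList (lam : Multiset ℕ) : List ℕ :=
  (lam.sort (· ≤ ·)).reverse

/-- The beta-set (set of beta-numbers) of `lam` with `m` beads:
`{ lam_i + (m - i) : 1 ≤ i ≤ m }` where `lam` is padded with zero parts. -/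
def betaSet (lam : Multiset ℕ) (m : ℕ) : Finset ℕ :=
  (Finset.range m).image (fun i => (descList lam).getD i 0 + (m - 1 - i))

/-- `mu` is obtained from `lam` by removing an `e`-hook: in some beta-set of
`lam` a beta-number `x` is replaced by `x - e` (which is not a beta-number). -/
def IsHookRemoval (e : ℕ) (lam mu : Multiset ℕ) : Prop :=
  (∀ x ∈ lam, 0 < x) ∧ (∀ x ∈ mu, 0 < x) ∧ 0 < e ∧
  ∃ m x, Multiset.card lam ≤ m ∧ Multiset.card mu ≤ m ∧
    x ∈ betaSet lam m ∧ e ≤ x ∧ x - e ∉ betaSet lam m ∧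
    betaSet mu m = insert (x - e) ((betaSet lam m).erase x)

/-- The map `f_k` : for an odd partition `lam` with `2^k ≤ |lam|`, the unique
odd partition obtained from `lam` by removing a `2^k`-hook (junk value `0` if
no such partition exists). -/
noncomputable def fkOp (k : ℕ) (lam : Multiset ℕ) : Multiset ℕ :=
  if h : ∃ mu, IsHookRemoval (2 ^ k) lam mu ∧ OddP mu then h.choose else 0

/-- The partition encoded by a finite beta-set: each bead contributes a part
equal to the number of gaps below it. -/
def partOfBeta (S : Finset ℕ) : Multiset ℕ :=
  (S.val.map (fun b => b - (S.filter (fun a => a < b)).card)).filter (fun p => 0 < p)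

/-- The 2-quotient `(lam_0, lam_1)` of `lam`, computed from a beta-set with an
even number of beads via the two runners of the 2-abacus. -/
def quot2 (lam : Multiset ℕ) : Multiset ℕ × Multiset ℕ :=
  (partOfBeta (((betaSet lam (2 * Multiset.card lam)).filter (fun b => b % 2 = 0)).image
      (fun b => b / 2)),
   partOfBeta (((betaSet lam (2 * Multiset.card lam)).filter (fun b => b % 2 = 1)).image
      (fun b => b / 2)))

/-- The `e`-core of `lam`: push all beads of an `e`-abacus configuration for
`lam` up as far as possible. -/
def coreP (e : ℕ) (lam : Multiset ℕ) : Multiset ℕ :=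
  partOfBeta ((Finset.range (e * (Multiset.card lam + e))).filter
    (fun x => x / e <
      ((betaSet lam (Multiset.card lam + e)).filter (fun b => b % e = x % e)).card))

/-- Row `k` of the 2-quotient tower of `lam`: row 0 is `[lam]`, and row `k+1`
replaces each entry of row `k` by its 2-quotient pair. -/
def towerRow : ℕ → Multiset ℕ → List (Multiset ℕ)
  | 0, lam => [lam]
  | (k + 1), lam => (towerRow k lam).flatMap (fun mu => [(quot2 mu).1, (quot2 mu).2])

/-- `R_k^j(lam)`: the component of row `k` of the 2-quotient tower of `lam`
from which a `2^(j-k)`-hook is removed in the passage from `lam` to `f_j(lam)`;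
it is characterized by: row `k` for `f_j(lam)` is obtained from row `k` for
`lam` by replacing this component by its image under `f_(j-k)`. -/
noncomputable def Rcomp (k j : ℕ) (lam : Multiset ℕ) : Multiset ℕ :=
  if h : ∃ s, s < 2 ^ k ∧
      towerRow k (fkOp j lam) =
        (towerRow k lam).set s (fkOp (j - k) ((towerRow k lam).getD s 0))
  then (towerRow k lam).getD h.choose 0 else 0

/-! ### Beta-sets and partitions -/

/-- The beads `f i + (m - 1 - i)` of a weakly decreasing sequence `f`. -/
def beads (f : ℕ → ℕ) (m : ℕ) : Finset ℕ :=
  (Finset.range m).image (fun i => f i + (m - 1 - i))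

lemma beads_injOn {f : ℕ → ℕ} (hf : Antitone f) (m : ℕ) :
    Set.InjOn (fun i => f i + (m - 1 - i)) (Finset.range m : Set ℕ) := by
  intro i hi j hj hij
  simp only [Finset.coe_range, Set.mem_Iio] at hi hj hij
  rcases lt_trichotomy i j with h | h | h
  · have := hf h.le
    omega
  · exact h
  · have := hf h.le
    omega

lemma card_beads {f : ℕ → ℕ} (hf : Antitone f) (m : ℕ) : (beads f m).card = m := by
  rw [beads, Finset.card_image_of_injOn (beads_injOn hf m), Finset.card_range]

lemma card_beads_filter_lt {f : ℕ → ℕ} (hf : Antitone f) {m i : ℕ} (hi : i < m) :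
    ((beads f m).filter (fun a => a < f i + (m - 1 - i))).card = m - 1 - i := by
  have h : (beads f m).filter (fun a => a < f i + (m - 1 - i)) =
      (Finset.Ioo i m).image (fun i => f i + (m - 1 - i)) := by
    ext a
    simp only [beads, Finset.mem_filter, Finset.mem_image, Finset.mem_range, Finset.mem_Ioo]
    constructor
    · rintro ⟨⟨j, hj, rfl⟩, hlt⟩
      refine ⟨j, ⟨?_, hj⟩, rfl⟩
      by_contra hji
      have := hf (not_lt.mp hji)
      omega
    · rintro ⟨j, ⟨hij, hj⟩, rfl⟩
      have := hf hij.le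
      exact ⟨⟨j, hj, rfl⟩, by omega⟩
  rw [h, Finset.card_image_of_injOn, Nat.card_Ioo]
  · omega
  · refine (beads_injOn hf m).mono ?_
    intro j hj
    simp only [Finset.coe_Ioo, Set.mem_Ioo] at hj
    simpa using hj.2

/-- The parts of the partition of a beta-set, one for each bead, zero parts included. -/
def paddedParts (S : Finset ℕ) : Multiset ℕ :=
  S.val.map (fun b => b - (S.filter (fun a => a < b)).card)

lemma partOfBeta_eq (S : Finset ℕ) :
    partOfBeta S = (paddedParts S).filter (fun p => 0 < p) := rfl

lemma paddedParts_beads {f : ℕ → ℕ} (hf : Antitone f) (m : ℕ) :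
    paddedParts (beads f m) = (Multiset.range m).map f := by
  have h : (beads f m).val = (Finset.range m).val.map (fun i => f i + (m - 1 - i)) :=
    Finset.image_val_of_injOn (beads_injOn hf m)
  rw [paddedParts, h, Multiset.map_map]
  refine Multiset.map_congr rfl ?_
  intro i hi
  have hi' : i < m := by simpa using hi
  simp only [Function.comp]
  rw [card_beads_filter_lt hf hi']
  omega

lemma exists_beads (S : Finset ℕ) :
    ∃ f : ℕ → ℕ, Antitone f ∧ (∀ i, S.card ≤ i → f i = 0) ∧ beads f S.card = S := by
  induction S using Finset.induction_on_max with
  | empty => exact ⟨fun _ => 0, fun _ _ _ => le_rfl, fun _ _ => rfl, by simp [beads]⟩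
  | insert M S hM ih =>
    obtain ⟨f, hf, hf0, hfS⟩ := ih
    have hMS : M ∉ S := fun h => lt_irrefl _ (hM M h)
    have key : f 0 + S.card ≤ M := by
      rcases Nat.eq_zero_or_pos S.card with h | h
      · rw [h, hf0 0 h.le]
        omega
      · have : f 0 + (S.card - 1 - 0) ∈ S :=
          hfS.subset (Finset.mem_image.mpr ⟨0, Finset.mem_range.mpr h, rfl⟩)
        have := hM _ this
        omega
    refine ⟨fun i => Nat.casesOn i (M - S.card) f, ?_, ?_, ?_⟩
    · refine antitone_nat_of_succ_le ?_
      rintro (_ | i)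
      · change f 0 ≤ M - S.card
        omega
      · exact hf (Nat.le_succ i)
    · rintro (_ | i) hi
      · rw [Finset.card_insert_of_notMem hMS] at hi
        omega
      · rw [Finset.card_insert_of_notMem hMS] at hi
        exact hf0 i (by omega)
    · rw [Finset.card_insert_of_notMem hMS]
      conv_rhs => rw [← hfS]
      ext a
      simp only [beads, Finset.mem_image, Finset.mem_range, Finset.mem_insert]
      constructor
      · rintro ⟨_ | i, hi, rfl⟩
        · left
          change M - S.card + (S.card + 1 - 1 - 0) = M
          omega
        · right
          refine ⟨i, by omega, ?_⟩
          change f i + _ = f i + _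
          omega
      · rintro (rfl | ⟨i, hi, rfl⟩)
        · refine ⟨0, by omega, ?_⟩
          change a - S.card + (S.card + 1 - 1 - 0) = a
          omega
        · refine ⟨i + 1, by omega, ?_⟩
          change f i + _ = f i + _
          omega

/-- The parts of a partition as a sequence, extended by zeros. -/
def partSeq (lam : Multiset ℕ) (i : ℕ) : ℕ := (descList lam).getD i 0

lemma betaSet_eq (lam : Multiset ℕ) (m : ℕ) : betaSet lam m = beads (partSeq lam) m := rfl

lemma descList_sorted (lam : Multiset ℕ) : (descList lam).Pairwise (· ≥ ·) := by
  rw [descList, List.pairwise_reverse]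
  exact Multiset.pairwise_sort lam (· ≤ ·)

lemma coe_descList (lam : Multiset ℕ) : (descList lam : Multiset ℕ) = lam := by
  rw [descList, Multiset.coe_reverse, Multiset.sort_eq]

lemma length_descList (lam : Multiset ℕ) : (descList lam).length = Multiset.card lam := by
  conv_rhs => rw [← coe_descList lam]
  simp

lemma descList_coe {l : List ℕ} (hl : l.Pairwise (· ≥ ·)) :
    descList (l : Multiset ℕ) = l := by
  refine List.Perm.eq_of_pairwise (le := (· ≥ ·)) ?_ (descList_sorted _) hl ?_
  · intro a b _ _ h1 h2
    exact le_antisymm h2 h1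
  · rw [← Multiset.coe_eq_coe, coe_descList]

lemma antitone_getD {l : List ℕ} (hl : l.Pairwise (· ≥ ·)) :
    Antitone (fun i => l.getD i 0) := by
  intro i j hij
  simp only [List.getD_eq_getElem?_getD]
  by_cases hj : j < l.length
  · have hi : i < l.length := lt_of_le_of_lt hij hj
    rw [List.getElem?_eq_getElem hj, List.getElem?_eq_getElem hi]
    rcases hij.eq_or_lt with rfl | h
    · exact le_rfl
    · exact List.pairwise_iff_getElem.mp hl i j hi hj h
  · rw [List.getElem?_eq_none (not_lt.mp hj)]
    simp

lemma partSeq_antitone (lam : Multiset ℕ) : Antitone (partSeq lam) :=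
  antitone_getD (descList_sorted lam)

lemma partSeq_eq_zero {lam : Multiset ℕ} {i : ℕ} (h : Multiset.card lam ≤ i) :
    partSeq lam i = 0 := by
  rw [partSeq, List.getD_eq_getElem?_getD, List.getElem?_eq_none]
  · rfl
  · rwa [length_descList]

lemma map_range_getD_filter (l : List ℕ) (m : ℕ) (hm : l.length ≤ m) :
    ((List.range m).map (fun i => l.getD i 0)).filter (fun p => 0 < p) =
      l.filter (fun p => 0 < p) := by
  have h : (List.range m).map (fun i => l.getD i 0) = l ++ List.replicate (m - l.length) 0 := by
    refine List.ext_getElem (by simp; omega) ?_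
    intro i h1 h2
    simp only [List.getElem_map, List.getElem_range, List.getD_eq_getElem?_getD]
    by_cases hi : i < l.length
    · rw [List.getElem_append_left hi, List.getElem?_eq_getElem hi]
      rfl
    · rw [List.getElem_append_right (not_lt.mp hi), List.getElem?_eq_none (not_lt.mp hi)]
      simp
  rw [h, List.filter_append]
  simp

lemma partOfBeta_betaSet {lam : Multiset ℕ} (hpos : ∀ x ∈ lam, 0 < x) {m : ℕ}
    (hm : Multiset.card lam ≤ m) : partOfBeta (betaSet lam m) = lam := by
  rw [partOfBeta_eq, betaSet_eq, paddedParts_beads (partSeq_antitone lam)]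
  have h := map_range_getD_filter (descList lam) m (by rwa [length_descList])
  have h2 : (Multiset.range m).map (partSeq lam) =
      (((List.range m).map (fun i => (descList lam).getD i 0) : List ℕ) : Multiset ℕ) := rfl
  rw [h2, Multiset.filter_coe, h, ← Multiset.filter_coe, coe_descList, Multiset.filter_eq_self]
  exact hpos

lemma getD_filter_pos {l : List ℕ} (hl : l.Pairwise (· ≥ ·)) (i : ℕ) :
    (l.filter (fun p => 0 < p)).getD i 0 = l.getD i 0 := by
  induction l generalizing i with
  | nil => rfl
  | cons a l ih =>
    rw [List.pairwise_cons] at hl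
    rcases Nat.eq_zero_or_pos a with rfl | ha
    · have h0 : ∀ b ∈ (0 :: l), b = 0 := by
        intro b hb
        rcases List.mem_cons.mp hb with rfl | hb
        · rfl
        · exact Nat.le_zero.mp (hl.1 b hb)
      have h1 : (0 :: l).filter (fun p => 0 < p) = [] := by
        rw [List.filter_eq_nil_iff]
        intro b hb
        simp [h0 b hb]
      rw [h1, List.getD_eq_getElem?_getD, List.getD_eq_getElem?_getD]
      by_cases hi : i < (0 :: l).length
      · rw [List.getElem?_eq_getElem hi]
        simpa using (h0 _ (List.getElem_mem hi)).symm
      · rw [List.getElem?_eq_none (not_lt.mp hi)]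
        rfl
    · rw [List.filter_cons_of_pos (by simpa using ha)]
      cases i with
      | zero => rfl
      | succ i => simpa using ih hl.2 i

lemma betaSet_partOfBeta (S : Finset ℕ) : betaSet (partOfBeta S) S.card = S := by
  obtain ⟨f, hf, -, hS⟩ := exists_beads S
  have hl : ((List.range S.card).map f).Pairwise (· ≥ ·) := by
    rw [List.pairwise_map]
    exact List.pairwise_lt_range.imp fun h => hf h.le
  have h1 : partOfBeta S =
      ((((List.range S.card).map f).filter (fun p => 0 < p) : List ℕ) : Multiset ℕ) := by
    conv_lhs => rw [← hS, partOfBeta_eq, paddedParts_beads hf]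
    rfl
  conv_rhs => rw [← hS]
  rw [betaSet_eq, beads, beads]
  refine Finset.image_congr ?_
  intro i hi
  have hi' : i < S.card := by simpa using hi
  have : partSeq (partOfBeta S) i = f i := by
    rw [partSeq, h1, descList_coe (hl.filter _), getD_filter_pos hl]
    simp [List.getD_eq_getElem?_getD, hi']
  simp only [this]

lemma pos_of_mem_partOfBeta {S : Finset ℕ} : ∀ x ∈ partOfBeta S, 0 < x := by
  intro x hx
  exact (Multiset.mem_filter.mp hx).2

lemma card_partOfBeta_le (S : Finset ℕ) : Multiset.card (partOfBeta S) ≤ S.card := by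
  refine (Multiset.card_le_card (Multiset.filter_le _ _)).trans ?_
  simp

lemma card_betaSet (lam : Multiset ℕ) (m : ℕ) : (betaSet lam m).card = m :=
  card_beads (partSeq_antitone lam) m

lemma partOfBeta_injOn {S T : Finset ℕ} (hc : S.card = T.card)
    (h : partOfBeta S = partOfBeta T) : S = T := by
  rw [← betaSet_partOfBeta S, ← betaSet_partOfBeta T, h, hc]

/-- The size of the partition encoded by a beta-set. -/
def bsize (S : Finset ℕ) : ℕ := (partOfBeta S).sum

lemma sum_filter_pos (s : Multiset ℕ) : (s.filter (fun p => 0 < p)).sum = s.sum := by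
  induction s using Multiset.induction with
  | empty => rfl
  | cons a s ih =>
    rcases Nat.eq_zero_or_pos a with rfl | ha
    · simpa using ih
    · rw [Multiset.filter_cons_of_pos (p := fun p => 0 < p) s ha]
      simp [ih]

lemma sum_eq_bsize_add (S : Finset ℕ) : ∑ b ∈ S, b = bsize S + ∑ i ∈ Finset.range S.card, i := by
  obtain ⟨f, hf, -, hS⟩ := exists_beads S
  have h1 : bsize S = ∑ i ∈ Finset.range S.card, f i := by
    rw [bsize, partOfBeta_eq, sum_filter_pos]
    conv_lhs => rw [← hS, paddedParts_beads hf]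
    rfl
  rw [h1, ← Finset.sum_range_reflect (fun i => i) S.card, ← Finset.sum_add_distrib]
  conv_lhs => rw [← hS]
  rw [beads, Finset.sum_image (beads_injOn hf _)]

/-- The beta-set with one more bead encoding the same partition. -/
def shift (S : Finset ℕ) : Finset ℕ := insert 0 (S.image (· + 1))

lemma mem_shift {S : Finset ℕ} {a : ℕ} : a ∈ shift S ↔ a = 0 ∨ ∃ b ∈ S, b + 1 = a := by
  simp [shift]

lemma betaSet_succ {lam : Multiset ℕ} {m : ℕ} (hm : Multiset.card lam ≤ m) :
    betaSet lam (m + 1) = shift (betaSet lam m) := by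
  ext a
  rw [mem_shift]
  simp only [betaSet_eq, beads, Finset.mem_image, Finset.mem_range]
  constructor
  · rintro ⟨i, hi, rfl⟩
    rcases (Nat.lt_succ_iff.mp hi).eq_or_lt with rfl | h
    · left
      rw [partSeq_eq_zero hm]
      omega
    · right
      exact ⟨_, ⟨i, h, rfl⟩, by omega⟩
  · rintro (rfl | ⟨b, ⟨i, hi, rfl⟩, rfl⟩)
    · exact ⟨m, by omega, by rw [partSeq_eq_zero hm]; omega⟩
    · exact ⟨i, by omega, by omega⟩

lemma partOfBeta_shift (S : Finset ℕ) : partOfBeta (shift S) = partOfBeta S := by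
  conv_lhs => rw [← betaSet_partOfBeta S]
  rw [← betaSet_succ (card_partOfBeta_le S)]
  exact partOfBeta_betaSet pos_of_mem_partOfBeta ((card_partOfBeta_le S).trans (Nat.le_succ _))

/-! ### Moving beads -/

/-- The beads that can be moved down by `e`, i.e. the `e`-hooks. -/
def movable (e : ℕ) (S : Finset ℕ) : Finset ℕ := S.filter (fun x => e ≤ x ∧ x - e ∉ S)

/-- The beta-set after moving the bead `x` down by `e`. -/
def move (e : ℕ) (S : Finset ℕ) (x : ℕ) : Finset ℕ := insert (x - e) (S.erase x)

lemma mem_movable {e : ℕ} {S : Finset ℕ} {x : ℕ} :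
    x ∈ movable e S ↔ x ∈ S ∧ e ≤ x ∧ x - e ∉ S := by
  simp [movable]

lemma mem_move {e : ℕ} {S : Finset ℕ} {x a : ℕ} :
    a ∈ move e S x ↔ a = x - e ∨ (a ≠ x ∧ a ∈ S) := by
  simp [move]

lemma card_move {e : ℕ} {S : Finset ℕ} {x : ℕ} (hx : x ∈ movable e S) :
    (move e S x).card = S.card := by
  rw [mem_movable] at hx
  rw [move, Finset.card_insert_of_notMem (fun h => hx.2.2 (Finset.mem_of_mem_erase h)),
    Finset.card_erase_add_one hx.1]

lemma bsize_move {e : ℕ} {S : Finset ℕ} {x : ℕ} (hx : x ∈ movable e S) :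
    bsize (move e S x) + e = bsize S := by
  have h1 := sum_eq_bsize_add S
  have h2 := sum_eq_bsize_add (move e S x)
  rw [card_move hx] at h2
  rw [mem_movable] at hx
  rw [move, Finset.sum_insert (fun h => hx.2.2 (Finset.mem_of_mem_erase h)), ← move] at h2
  have h3 := Finset.add_sum_erase S (fun b => b) hx.1
  omega

/-- The part of the partition contributed by the bead `b`. -/
def beadPart (S : Finset ℕ) (b : ℕ) : ℕ := b - (S.filter (fun a => a < b)).card

lemma rank_le (S : Finset ℕ) (b : ℕ) : (S.filter (fun a => a < b)).card ≤ b := by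
  calc (S.filter (fun a => a < b)).card ≤ (Finset.range b).card :=
        Finset.card_le_card fun a ha => by simpa using (Finset.mem_filter.mp ha).2
    _ = b := Finset.card_range b

lemma rank_lt {S : Finset ℕ} {b : ℕ} (h0 : 1 ≤ b) (h : b - 1 ∉ S) :
    (S.filter (fun a => a < b)).card < b := by
  have h1 : S.filter (fun a => a < b) = S.filter (fun a => a < b - 1) := by
    ext a
    simp only [Finset.mem_filter, and_congr_right_iff]
    intro ha
    have : a ≠ b - 1 := fun h' => h (h' ▸ ha)
    omega
  have := rank_le S (b - 1)
  rw [h1]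
  omega

lemma rank_succ {S : Finset ℕ} {b : ℕ} (h0 : 1 ≤ b) (h : b - 1 ∈ S) :
    (S.filter (fun a => a < b)).card = (S.filter (fun a => a < b - 1)).card + 1 := by
  have h1 : S.filter (fun a => a < b) = insert (b - 1) (S.filter (fun a => a < b - 1)) := by
    ext a
    simp only [Finset.mem_filter, Finset.mem_insert]
    constructor
    · rintro ⟨ha, hlt⟩
      by_cases hab : a = b - 1
      · exact Or.inl hab
      · exact Or.inr ⟨ha, by omega⟩
    · rintro (rfl | ⟨ha, hlt⟩)
      · exact ⟨h, by omega⟩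
      · exact ⟨ha, by omega⟩
  rw [h1, Finset.card_insert_of_notMem (by simp)]

lemma beadPart_lt {S : Finset ℕ} {x y : ℕ} (hxy : x < y) (hy : y ∈ movable 1 S) :
    beadPart S x < beadPart S y := by
  rw [mem_movable] at hy
  have h1 : S.filter (fun a => a < y) ⊆
      S.filter (fun a => a < x) ∪ Finset.Ico x (y - 1) := by
    intro a ha
    simp only [Finset.mem_filter, Finset.mem_union, Finset.mem_Ico] at ha ⊢
    have : a ≠ y - 1 := fun h' => hy.2.2 (h' ▸ ha.1)
    by_cases h : a < x
    · exact Or.inl ⟨ha.1, h⟩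
    · exact Or.inr ⟨by omega, by omega⟩
  have h2 := (Finset.card_le_card h1).trans (Finset.card_union_le _ _)
  rw [Nat.card_Ico] at h2
  have h3 := rank_le S x
  unfold beadPart
  omega

lemma paddedParts_eq_cons {S : Finset ℕ} {x : ℕ} (hx : x ∈ S) :
    paddedParts S = beadPart S x ::ₘ (S.erase x).val.map (beadPart S) := by
  conv_lhs => rw [paddedParts]
  rw [← Multiset.map_cons, Finset.erase_val, Multiset.cons_erase hx]
  rfl

lemma paddedParts_move_one {S : Finset ℕ} {x : ℕ} (hx : x ∈ movable 1 S) :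
    paddedParts (move 1 S x) = (beadPart S x - 1) ::ₘ (S.erase x).val.map (beadPart S) := by
  rw [mem_movable] at hx
  rw [paddedParts]
  conv_lhs =>
    arg 2
    rw [move, Finset.insert_val_of_notMem (fun h => hx.2.2 (Finset.mem_of_mem_erase h))]
  rw [Multiset.map_cons]
  congr 1
  · have h1 : (move 1 S x).filter (fun a => a < x - 1) = S.filter (fun a => a < x) := by
      ext a
      simp only [Finset.mem_filter, mem_move]
      constructor
      · rintro ⟨h | h, h'⟩
        · omega
        · exact ⟨h.2, by omega⟩
      · rintro ⟨ha, hlt⟩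
        have : a ≠ x - 1 := fun h' => hx.2.2 (h' ▸ ha)
        exact ⟨Or.inr ⟨by omega, ha⟩, by omega⟩
    rw [h1, beadPart]
    omega
  · refine Multiset.map_congr rfl ?_
    intro b hb
    have hb' : b ≠ x ∧ b ∈ S := Finset.mem_erase.mp hb
    have hbx : b ≠ x - 1 := fun h' => hx.2.2 (h' ▸ hb'.2)
    rw [beadPart]
    congr 1
    by_cases hlt : x < b
    · have h1 : (move 1 S x).filter (fun a => a < b) =
          insert (x - 1) ((S.filter (fun a => a < b)).erase x) := by
        ext a
        simp only [Finset.mem_filter, mem_move, Finset.mem_insert, Finset.mem_erase]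
        constructor
        · rintro ⟨h | h, h'⟩
          · exact Or.inl h
          · exact Or.inr ⟨h.1, h.2, h'⟩
        · rintro (h | h)
          · exact ⟨Or.inl h, by omega⟩
          · exact ⟨Or.inr ⟨h.1, h.2.1⟩, h.2.2⟩
      rw [h1, Finset.card_insert_of_notMem (by simp [hx.2.2]), Finset.card_erase_add_one]
      simp [hx.1, hlt]
    · congr 1
      ext a
      simp only [Finset.mem_filter, mem_move]
      constructor
      · rintro ⟨h | h, h'⟩
        · omega
        · exact ⟨h.2, h'⟩
      · rintro ⟨h, h'⟩
        exact ⟨Or.inr ⟨by omega, h⟩, h'⟩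

lemma removeBox_beadPart {S : Finset ℕ} {x : ℕ} (hx : x ∈ movable 1 S) :
    removeBox (partOfBeta S) (beadPart S x) = partOfBeta (move 1 S x) := by
  have hx' := mem_movable.mp hx
  have hpos : 0 < beadPart S x := by
    have := rank_lt hx'.2.1 hx'.2.2
    unfold beadPart
    omega
  rw [partOfBeta_eq, partOfBeta_eq, paddedParts_move_one hx, paddedParts_eq_cons hx'.1,
    Multiset.filter_cons_of_pos (p := fun p => 0 < p) _ hpos, removeBox, Multiset.erase_cons_head]
  split
  · rw [Multiset.filter_cons_of_neg (p := fun p => 0 < p)]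
    omega
  · rw [Multiset.filter_cons_of_pos (p := fun p => 0 < p)]
    omega

lemma exists_movable_beadPart {S : Finset ℕ} {p : ℕ} (hp : p ∈ partOfBeta S) :
    ∃ x ∈ movable 1 S, beadPart S x = p := by
  have hpos := pos_of_mem_partOfBeta p hp
  have hex : ∃ x, x ∈ S ∧ beadPart S x = p := by
    rw [partOfBeta_eq, Multiset.mem_filter] at hp
    simpa [paddedParts, beadPart] using hp.1
  obtain ⟨hxS, hxp⟩ := Nat.find_spec hex
  have hmin := fun y (hy : y < Nat.find hex) => Nat.find_min hex hy
  generalize Nat.find hex = x at hxS hxp hmin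
  have hx1 : 1 ≤ x := by
    rw [← hxp, beadPart] at hpos
    omega
  refine ⟨x, ?_, hxp⟩
  rw [mem_movable]
  refine ⟨hxS, hx1, fun h' => hmin (x - 1) (by omega) ⟨h', ?_⟩⟩
  have := rank_succ hx1 h'
  rw [← hxp, beadPart, beadPart]
  omega

lemma degSYT_partOfBeta {S : Finset ℕ} (h : partOfBeta S ≠ 0) :
    degSYT (partOfBeta S) = ∑ x ∈ movable 1 S, degSYT (partOfBeta (move 1 S x)) := by
  rw [degSYT, dif_neg h]
  rw [Finset.sum_attach ((partOfBeta S).toFinset.filter (fun p => 0 < p))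
    (fun p => degSYT (removeBox (partOfBeta S) p))]
  symm
  refine Finset.sum_nbij (beadPart S) ?_ ?_ ?_ ?_
  · intro x hx
    have hx' := mem_movable.mp hx
    have hpos : 0 < beadPart S x := by
      have := rank_lt hx'.2.1 hx'.2.2
      unfold beadPart
      omega
    rw [Finset.mem_filter, Multiset.mem_toFinset, partOfBeta_eq, Multiset.mem_filter]
    exact ⟨⟨Multiset.mem_map_of_mem _ hx'.1, hpos⟩, hpos⟩
  · intro x hx y hy hxy
    rcases lt_trichotomy x y with h | h | h
    · exact absurd hxy (beadPart_lt h hy).ne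
    · exact h
    · exact absurd hxy (beadPart_lt h hx).ne'
  · intro p hp
    simp only [Finset.coe_filter, Set.mem_ofPred_eq, Multiset.mem_toFinset] at hp
    exact exists_movable_beadPart hp.1
  · intro x hx
    rw [removeBox_beadPart hx]

/-! ### Degrees modulo two -/

/-- The degree of the partition of a beta-set, modulo two. -/
def parity (S : Finset ℕ) : ZMod 2 := (degSYT (partOfBeta S) : ZMod 2)

lemma oddP_partOfBeta {S : Finset ℕ} : OddP (partOfBeta S) ↔ parity S = 1 := by
  rw [OddP, parity, ZMod.natCast_eq_one_iff_odd]
  exact and_iff_right pos_of_mem_partOfBeta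

/-- The sum of `F` over all results of moving one bead down by `e`. -/
def moveSum (e : ℕ) (F : Finset ℕ → ZMod 2) (S : Finset ℕ) : ZMod 2 :=
  ∑ x ∈ movable e S, F (move e S x)

lemma moveSum_one_parity {S : Finset ℕ} (h : 1 ≤ bsize S) : moveSum 1 parity S = parity S := by
  have h0 : partOfBeta S ≠ 0 := by
    intro h0
    rw [bsize, h0] at h
    simp at h
  rw [moveSum, parity, degSYT_partOfBeta h0]
  simp [parity]

lemma movable_move {e : ℕ} (he : 0 < e) {S : Finset ℕ} {x y : ℕ} (hx : x ∈ movable e S) :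
    y ∈ movable e (move e S x) ↔ (y ∈ movable e S ∧ y ≠ x) ∨
      (y = x - e ∧ x ∈ movable (e + e) S) ∨ (y = x + e ∧ x + e ∈ movable (e + e) S) := by
  simp only [mem_movable, mem_move] at hx ⊢
  obtain ⟨hxS, hex, hxe⟩ := hx
  rw [show x - (e + e) = x - e - e by omega, show x + e - (e + e) = x - e by omega]
  by_cases h1 : y = x - e
  · subst h1
    constructor
    · rintro ⟨-, h2, h3⟩
      refine Or.inr (Or.inl ⟨rfl, hxS, by omega, fun h => h3 (Or.inr ⟨by omega, h⟩)⟩)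
    · rintro (⟨⟨h, -⟩, -⟩ | ⟨-, -, h, h'⟩ | ⟨h, -⟩)
      · exact absurd h hxe
      · refine ⟨Or.inl rfl, by omega, ?_⟩
        rintro (h'' | h'')
        · omega
        · exact h' h''.2
      · omega
  · by_cases h2 : y = x + e
    · subst h2
      constructor
      · rintro ⟨h3 | h3, -, h4⟩
        · omega
        · exact Or.inr (Or.inr ⟨rfl, h3.2, by omega, hxe⟩)
      · rintro (⟨⟨-, -, h⟩, -⟩ | ⟨h, -⟩ | ⟨-, h, -, -⟩)
        · rw [Nat.add_sub_cancel] at h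
          exact absurd hxS h
        · omega
        · refine ⟨Or.inr ⟨by omega, h⟩, by omega, ?_⟩
          rw [Nat.add_sub_cancel]
          rintro (h | h)
          · omega
          · exact h.1 rfl
    · constructor
      · rintro ⟨h3 | h3, h4, h5⟩
        · omega
        · exact Or.inl ⟨⟨h3.2, h4, fun h => h5 (Or.inr ⟨by omega, h⟩)⟩, h3.1⟩
      · rintro (⟨⟨h, h', h''⟩, h3⟩ | ⟨h, -⟩ | ⟨h, -⟩)
        · refine ⟨Or.inr ⟨h3, h⟩, h', ?_⟩
          rintro (h4 | h4)
          · omega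
          · exact h'' h4.2
        · omega
        · omega

lemma sum_offDiag_eq_zero (A : Finset ℕ) (G : ℕ → ℕ → ZMod 2)
    (hG : ∀ x ∈ A, ∀ y ∈ A, x ≠ y → G x y = G y x) :
    ∑ x ∈ A, ∑ y ∈ A.erase x, G x y = 0 := by
  rw [Finset.sum_sigma']
  refine Finset.sum_involution (fun p _ => ⟨p.2, p.1⟩) ?_ ?_ ?_ ?_
  · rintro ⟨x, y⟩ h
    simp only [Finset.mem_sigma, Finset.mem_erase] at h
    simp only
    rw [hG y h.2.2 x h.1 h.2.1]
    exact CharTwo.add_self_eq_zero _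
  · rintro ⟨x, y⟩ h - h'
    simp only [Finset.mem_sigma, Finset.mem_erase] at h
    simp only [Sigma.mk.injEq] at h'
    exact h.2.1 h'.1
  · rintro ⟨x, y⟩ h
    simp only [Finset.mem_sigma, Finset.mem_erase] at h ⊢
    exact ⟨h.2.2, h.2.1.symm, h.1⟩
  · rintro ⟨x, y⟩ h
    rfl

lemma move_comm {e e' : ℕ} {S : Finset ℕ} {x y : ℕ} (hx : x ∈ movable e S)
    (hy : y ∈ movable e' S) : move e' (move e S x) y = move e (move e' S y) x := by
  rw [mem_movable] at hx hy
  ext a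
  simp only [mem_move]
  constructor
  · rintro (rfl | ⟨h, rfl | h'⟩)
    · exact Or.inr ⟨fun h => hy.2.2 (h ▸ hx.1), Or.inl rfl⟩
    · exact Or.inl rfl
    · exact Or.inr ⟨h'.1, Or.inr ⟨h, h'.2⟩⟩
  · rintro (rfl | ⟨h, rfl | h'⟩)
    · exact Or.inr ⟨fun h => hx.2.2 (h ▸ hy.1), Or.inl rfl⟩
    · exact Or.inl rfl
    · exact Or.inr ⟨h'.1, Or.inr ⟨h, h'.2⟩⟩

lemma move_move_same {e : ℕ} {S : Finset ℕ} {x : ℕ} (hx : x ∈ movable e S) :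
    move e (move e S x) (x - e) = move (e + e) S x := by
  rw [mem_movable] at hx
  ext a
  simp only [mem_move, Nat.sub_sub]
  constructor
  · rintro (h | ⟨h, h' | h'⟩)
    · exact Or.inl h
    · exact absurd h' h
    · exact Or.inr h'
  · rintro (h | h)
    · exact Or.inl h
    · exact Or.inr ⟨fun h' => hx.2.2 (h' ▸ h.2), Or.inr h⟩

lemma move_move_above {e : ℕ} (he : 0 < e) {S : Finset ℕ} {x : ℕ} (hx : x ∈ movable e S) :
    move e (move e S x) (x + e) = move (e + e) S (x + e) := by
  rw [mem_movable] at hx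
  ext a
  simp only [mem_move, Nat.add_sub_cancel, Nat.add_sub_add_right]
  constructor
  · rintro (rfl | ⟨h, rfl | h'⟩)
    · exact Or.inr ⟨by omega, hx.1⟩
    · exact Or.inl rfl
    · exact Or.inr ⟨h, h'.2⟩
  · rintro (rfl | h)
    · exact Or.inr ⟨by omega, Or.inl rfl⟩
    · by_cases hax : a = x
      · exact Or.inl hax
      · exact Or.inr ⟨h.1, Or.inr ⟨hax, h.2⟩⟩

lemma sum_movable_move {e : ℕ} (he : 0 < e) {S : Finset ℕ} {x : ℕ} (hx : x ∈ movable e S)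
    (F : Finset ℕ → ZMod 2) :
    ∑ y ∈ movable e (move e S x), F (move e (move e S x) y) =
      ∑ y ∈ (movable e S).erase x, F (move e (move e S x) y) +
      ((if x ∈ movable (e + e) S then F (move (e + e) S x) else 0) +
        (if x + e ∈ movable (e + e) S then F (move (e + e) S (x + e)) else 0)) := by
  have hx' := mem_movable.mp hx
  have hset : movable e (move e S x) = (movable e S).erase x ∪
      ((if x ∈ movable (e + e) S then {x - e} else ∅) ∪
        (if x + e ∈ movable (e + e) S then {x + e} else ∅)) := by
    ext y
    rw [movable_move he hx]
    split_ifs with h1 h2 h2 <;> simp [h1, h2] <;> tauto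
  rw [hset, Finset.sum_union, Finset.sum_union]
  · congr 2
    · split_ifs
      · rw [Finset.sum_singleton, move_move_same hx]
      · rfl
    · split_ifs
      · rw [Finset.sum_singleton, move_move_above he hx]
      · rfl
  · rw [Finset.disjoint_left]
    intro a h1 h2
    split_ifs at h1 h2 <;> simp at h1 h2
    omega
  · rw [Finset.disjoint_left]
    intro a h1 h2
    rw [Finset.mem_erase, mem_movable] at h1
    rcases Finset.mem_union.mp h2 with h2 | h2
    · split_ifs at h2 <;> simp at h2
      rw [h2] at h1
      exact hx'.2.2 h1.2.1
    · split_ifs at h2 <;> simp at h2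
      rw [h2, Nat.add_sub_cancel] at h1
      exact h1.2.2.2 hx'.1

lemma moveSum_moveSum {e : ℕ} (he : 0 < e) (F : Finset ℕ → ZMod 2) (S : Finset ℕ) :
    moveSum e (moveSum e F) S = moveSum (e + e) F S := by
  have h0 : moveSum e (moveSum e F) S =
      ∑ x ∈ movable e S, (∑ y ∈ (movable e S).erase x, F (move e (move e S x) y) +
      ((if x ∈ movable (e + e) S then F (move (e + e) S x) else 0) +
        (if x + e ∈ movable (e + e) S then F (move (e + e) S (x + e)) else 0))) :=
    Finset.sum_congr rfl fun x hx => sum_movable_move he hx F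
  rw [h0, Finset.sum_add_distrib, sum_offDiag_eq_zero, zero_add, Finset.sum_add_distrib,
    ← Finset.sum_filter, ← Finset.sum_filter, moveSum,
    ← Finset.sum_filter_add_sum_filter_not (movable (e + e) S) (fun z => z - e ∉ S)]
  · congr 1
    · refine Finset.sum_congr ?_ fun _ _ => rfl
      ext z
      simp only [Finset.mem_filter, mem_movable]
      constructor
      · rintro ⟨h1, h2⟩
        exact ⟨h2, h1.2.2⟩
      · rintro ⟨h1, h2⟩
        exact ⟨⟨h1.1, by omega, h2⟩, h1⟩
    · refine Finset.sum_nbij' (· + e) (· - e) ?_ ?_ ?_ ?_ ?_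
      · intro x hx
        rw [Finset.mem_filter, mem_movable] at hx
        rw [Finset.mem_filter, Nat.add_sub_cancel, not_not]
        exact ⟨hx.2, hx.1.1⟩
      · intro z hz
        rw [Finset.mem_filter, not_not] at hz
        have hz' := mem_movable.mp hz.1
        rw [Finset.mem_filter, Nat.sub_add_cancel (by omega), mem_movable, Nat.sub_sub]
        exact ⟨⟨hz.2, by omega, hz'.2.2⟩, hz.1⟩
      · intro x _
        exact Nat.add_sub_cancel x e
      · intro z hz
        rw [Finset.mem_filter] at hz
        have hz' := mem_movable.mp hz.1
        exact Nat.sub_add_cancel (by omega)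
      · intro x _
        rfl
  · intro x hx y hy _
    rw [move_comm hx hy]

lemma moveSum_parity (k : ℕ) {S : Finset ℕ} (h : 2 ^ k ≤ bsize S) :
    moveSum (2 ^ k) parity S = parity S := by
  induction k generalizing S with
  | zero => exact moveSum_one_parity h
  | succ k ih =>
    rw [pow_succ, mul_two] at h ⊢
    rw [← moveSum_moveSum (by positivity)]
    have h1 : moveSum (2 ^ k) (moveSum (2 ^ k) parity) S = moveSum (2 ^ k) parity S := by
      refine Finset.sum_congr rfl fun x hx => ih ?_
      have := bsize_move hx
      omega
    rw [h1, ih (by omega)]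

/-- The beads whose move by `2 ^ k` yields a partition of odd degree. -/
def oddMoves (k : ℕ) (S : Finset ℕ) : Finset ℕ :=
  (movable (2 ^ k) S).filter (fun x => parity (move (2 ^ k) S x) = 1)

lemma mem_oddMoves {k : ℕ} {S : Finset ℕ} {x : ℕ} :
    x ∈ oddMoves k S ↔ x ∈ movable (2 ^ k) S ∧ parity (move (2 ^ k) S x) = 1 := by
  rw [oddMoves, Finset.mem_filter]

lemma odd_card_oddMoves {k : ℕ} {S : Finset ℕ} (hS : parity S = 1) (h : 2 ^ k ≤ bsize S) :
    Odd (oddMoves k S).card := by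
  have h1 := moveSum_parity k h
  have h2 : moveSum (2 ^ k) parity S = ((oddMoves k S).card : ZMod 2) := by
    rw [oddMoves, Finset.card_filter, Nat.cast_sum]
    refine Finset.sum_congr rfl fun x _ => ?_
    generalize parity (move (2 ^ k) S x) = a
    revert a
    decide
  rw [← ZMod.natCast_eq_one_iff_odd, ← h2, h1, hS]

lemma eq_of_mem_movable {e : ℕ} (he : 0 < e) {S : Finset ℕ} (h : bsize S < e + e) {x y : ℕ}
    (hx : x ∈ movable e S) (hy : y ∈ movable e S) : x = y := by
  by_contra hxy
  have h1 := bsize_move hx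
  have h2 := bsize_move ((movable_move he hx).mpr (Or.inl ⟨hy, Ne.symm hxy⟩))
  omega

lemma parity_move_top {t : ℕ} {S : Finset ℕ} (h1 : 2 ^ t ≤ bsize S) (h2 : bsize S < 2 ^ (t + 1))
    {x : ℕ} (hx : x ∈ movable (2 ^ t) S) : parity (move (2 ^ t) S x) = parity S := by
  have h3 : movable (2 ^ t) S = {x} := by
    ext y
    rw [Finset.mem_singleton]
    constructor
    · intro hy
      exact eq_of_mem_movable (by positivity) (by rw [pow_succ] at h2; omega) hy hx
    · rintro rfl
      exact hx
  rw [← moveSum_parity t h1, moveSum, h3, Finset.sum_singleton]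

lemma movable_of_movable_move {e e' : ℕ} {S : Finset ℕ} {x y : ℕ} (hy : y ∈ movable e' S)
    (hxy : y ≠ x) (h : y - e' ≠ x - e) :
    y ∈ movable e' (move e S x) := by
  rw [mem_movable] at hy ⊢
  rw [mem_move, mem_move]
  refine ⟨Or.inr ⟨hxy, hy.1⟩, hy.2.1, ?_⟩
  rintro (h' | h')
  · exact h h'
  · exact hy.2.2 h'.2

lemma mem_oddMoves_move_top {k t : ℕ} {S : Finset ℕ} {x y : ℕ}
    (h2 : bsize S < 2 ^ (t + 1)) (hx : x ∈ movable (2 ^ t) S) (hy : y ∈ oddMoves k S)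
    (hyx : y ≠ x) (hyu : y - 2 ^ k ≠ x - 2 ^ t) : y ∈ oddMoves k (move (2 ^ t) S x) := by
  rw [mem_oddMoves] at hy ⊢
  refine ⟨movable_of_movable_move hy.1 hyx hyu, ?_⟩
  have hx' := movable_of_movable_move hx hyx.symm hyu.symm
  rw [move_comm hx hy.1, parity_move_top _ _ hx', hy.2]
  · have := bsize_move hx'
    omega
  · have := bsize_move hy.1
    have : 0 < 2 ^ k := by positivity
    omega

lemma movable_move_down {k t : ℕ} {S : Finset ℕ} {x z : ℕ}
    (h2 : bsize S < 2 ^ (t + 1)) (hx : x ∈ movable (2 ^ t) S) (hxk : x ∈ movable (2 ^ k) S)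
    (hz : z ∈ movable (2 ^ t) (move (2 ^ k) S x)) : z = x - 2 ^ k := by
  have hx' := mem_movable.mp hx
  have hxk' := mem_movable.mp hxk
  have hz' := mem_movable.mp hz
  rw [mem_move, mem_move] at hz'
  rw [pow_succ] at h2
  rcases hz'.1 with h | ⟨hzx, hzS⟩
  · exact h
  · exfalso
    by_cases hzt : z - 2 ^ t = x
    · have hzm : z ∈ movable (2 ^ t) (move (2 ^ t) S x) := by
        rw [mem_movable, mem_move, mem_move]
        refine ⟨Or.inr ⟨hzx, hzS⟩, hz'.2.1, ?_⟩
        rintro (h | h)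
        · have := hx'.2.1
          have : 0 < 2 ^ t := by positivity
          omega
        · exact h.1 hzt
      have := bsize_move hx
      have := bsize_move hzm
      omega
    · have hzm : z ∈ movable (2 ^ t) S := by
        rw [mem_movable]
        exact ⟨hzS, hz'.2.1, fun h => hz'.2.2 (Or.inr ⟨hzt, h⟩)⟩
      exact hzx (eq_of_mem_movable (by positivity) (by omega) hzm hx)

lemma sub_mem_oddMoves {k t : ℕ} (hkt : k < t) {S : Finset ℕ} {x : ℕ}
    (h2 : bsize S < 2 ^ (t + 1)) (hk : 2 ^ k + 2 ^ t ≤ bsize S)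
    (hx : x ∈ movable (2 ^ t) S) (hxk : x ∈ oddMoves k S) :
    x - 2 ^ t ∈ oddMoves k (move (2 ^ t) S x) := by
  have hlt : 2 ^ k < 2 ^ t := Nat.pow_lt_pow_right (by norm_num) hkt
  have hpos : 0 < 2 ^ k := by positivity
  rw [mem_oddMoves] at hxk ⊢
  have hx' := mem_movable.mp hx
  have hxk' := mem_movable.mp hxk.1
  have hsz := bsize_move hxk.1
  obtain ⟨z, hz⟩ := (odd_card_oddMoves hxk.2 (show 2 ^ t ≤ _ by omega)).pos |> Finset.card_pos.mp
  rw [mem_oddMoves] at hz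
  obtain rfl := movable_move_down h2 hx hxk.1 hz.1
  have hz' := mem_movable.mp hz.1
  rw [mem_move, mem_move] at hz'
  have hmv : move (2 ^ k) (move (2 ^ t) S x) (x - 2 ^ t) =
      move (2 ^ t) (move (2 ^ k) S x) (x - 2 ^ k) := by
    ext a
    simp only [mem_move]
    rw [show x - 2 ^ t - 2 ^ k = x - 2 ^ k - 2 ^ t by omega]
    constructor
    · rintro (h | ⟨h, h' | h'⟩)
      · exact Or.inl h
      · exact absurd h' h
      · exact Or.inr ⟨fun h'' => hxk'.2.2 (h'' ▸ h'.2), Or.inr h'⟩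
    · rintro (h | ⟨h, h' | h'⟩)
      · exact Or.inl h
      · exact absurd h' h
      · exact Or.inr ⟨fun h'' => hx'.2.2 (h'' ▸ h'.2), Or.inr h'⟩
  rw [hmv]
  refine ⟨?_, hz.2⟩
  rw [mem_movable, mem_move, mem_move, show x - 2 ^ t - 2 ^ k = x - 2 ^ k - 2 ^ t by omega]
  refine ⟨Or.inl rfl, by omega, ?_⟩
  rintro (h | h)
  · omega
  · exact hz'.2.2 (Or.inr h)

/-- Isaacs, Navarro, Olsson and Tiep: the odd `2 ^ k`-hook is unique. -/
lemma oddMoves_unique (k : ℕ) {S : Finset ℕ} (hS : parity S = 1) {y z : ℕ}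
    (hy : y ∈ oddMoves k S) (hz : z ∈ oddMoves k S) : y = z := by
  induction hn : bsize S using Nat.strong_induction_on generalizing S y z with
  | _ n ih =>
  subst hn
  have hyb := bsize_move (mem_oddMoves.mp hy).1
  have hpos : 0 < 2 ^ k := by positivity
  obtain ⟨t, ht1, ht2⟩ : ∃ t, 2 ^ t ≤ bsize S ∧ bsize S < 2 ^ (t + 1) :=
    ⟨Nat.log 2 (bsize S), Nat.pow_log_le_self 2 (by omega),
      Nat.lt_pow_succ_log_self (by norm_num) _⟩
  have hkt : k ≤ t := by
    have : 2 ^ k < 2 ^ (t + 1) := by omega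
    have := (Nat.pow_lt_pow_iff_right (by norm_num : 1 < 2)).mp this
    omega
  rcases hkt.eq_or_lt with rfl | hkt
  · exact eq_of_mem_movable hpos (by rw [pow_succ] at ht2; omega) (mem_oddMoves.mp hy).1
      (mem_oddMoves.mp hz).1
  obtain ⟨x, hx⟩ := (odd_card_oddMoves hS ht1).pos |> Finset.card_pos.mp
  rw [mem_oddMoves] at hx
  obtain ⟨hx, hxp⟩ := hx
  have htpos : 0 < 2 ^ t := by positivity
  have hxb := bsize_move hx
  have hx' := mem_movable.mp hx
  have key : ∀ v ∈ oddMoves k S, v ≠ x → v ≠ x - 2 ^ t + 2 ^ k →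
      v ∈ oddMoves k (move (2 ^ t) S x) := by
    intro v hv hvx hvu
    refine mem_oddMoves_move_top ht2 hx hv hvx ?_
    have := (mem_movable.mp (mem_oddMoves.mp hv).1).2.1
    omega
  have hcard : (oddMoves k S).card ≤ 2 := by
    by_contra hc
    have hsub : (((oddMoves k S).erase x).erase (x - 2 ^ t + 2 ^ k)).card ≤ 1 := by
      rw [Finset.card_le_one]
      intro a ha b hb
      simp only [Finset.mem_erase] at ha hb
      exact ih _ (by omega) hxp (key a ha.2.2 ha.2.1 ha.1) (key b hb.2.2 hb.2.1 hb.1) rfl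
    have hc1 := Finset.pred_card_le_card_erase (s := (oddMoves k S).erase x)
      (a := x - 2 ^ t + 2 ^ k)
    have hc2 := Finset.pred_card_le_card_erase (s := oddMoves k S) (a := x)
    have hxm : x ∈ oddMoves k S := by
      by_contra hxm
      rw [Finset.erase_eq_of_notMem hxm] at hc1 hsub
      omega
    obtain ⟨v, hv⟩ : (((oddMoves k S).erase x).erase (x - 2 ^ t + 2 ^ k)).Nonempty := by
      rw [← Finset.card_pos]
      omega
    simp only [Finset.mem_erase] at hv
    have hvk := key v hv.2.2 hv.2.1 hv.1
    have hvb := bsize_move (mem_oddMoves.mp hvk).1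
    have huk := sub_mem_oddMoves hkt ht2 (by omega) hx hxm
    have huv := ih _ (by omega) hxp huk hvk rfl
    have hvS := (mem_movable.mp (mem_oddMoves.mp hv.2.2).1).1
    exact hx'.2.2 (huv ▸ hvS)
  have hodd := odd_card_oddMoves hS (show 2 ^ k ≤ bsize S by omega)
  have hone : (oddMoves k S).card ≤ 1 := by
    obtain ⟨a, ha⟩ := hodd
    omega
  exact Finset.card_le_one.mp hone y hy z hz

/-! ### Hook removals on partitions -/

lemma movable_shift {e : ℕ} {S : Finset ℕ} {x : ℕ} (hx : x ∈ movable e S) :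
    x + 1 ∈ movable e (shift S) ∧ move e (shift S) (x + 1) = shift (move e S x) := by
  rw [mem_movable] at hx
  constructor
  · rw [mem_movable, mem_shift, mem_shift]
    refine ⟨Or.inr ⟨x, hx.1, rfl⟩, by omega, ?_⟩
    rintro (h | ⟨b, hb, h⟩)
    · omega
    · obtain rfl : b = x - e := by omega
      exact hx.2.2 hb
  · ext a
    simp only [mem_move, mem_shift]
    constructor
    · rintro (h | ⟨h, h' | ⟨b, hb, h'⟩⟩)
      · exact Or.inr ⟨x - e, Or.inl rfl, by omega⟩
      · exact Or.inl h'
      · exact Or.inr ⟨b, Or.inr ⟨by omega, hb⟩, h'⟩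
    · rintro (h | ⟨b, h | h, h'⟩)
      · exact Or.inr ⟨by omega, Or.inl h⟩
      · exact Or.inl (by omega)
      · exact Or.inr ⟨by omega, Or.inr ⟨b, h.2, h'⟩⟩

lemma IsHookRemoval.exists_move {e : ℕ} {lam mu : Multiset ℕ} (h : IsHookRemoval e lam mu) :
    ∃ m, Multiset.card lam ≤ m ∧ Multiset.card mu ≤ m ∧ ∀ M, m ≤ M →
      ∃ x ∈ movable e (betaSet lam M), betaSet mu M = move e (betaSet lam M) x := by
  obtain ⟨-, -, -, m, x, h1, h2, h3, h4, h5, h6⟩ := h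
  refine ⟨m, h1, h2, fun M hM => ?_⟩
  induction M, hM using Nat.le_induction with
  | base => exact ⟨x, mem_movable.mpr ⟨h3, h4, h5⟩, h6⟩
  | succ M hM ih =>
    obtain ⟨x, hx, hxm⟩ := ih
    rw [betaSet_succ (h1.trans hM), betaSet_succ (h2.trans hM)]
    exact ⟨x + 1, (movable_shift hx).1, by rw [(movable_shift hx).2, hxm]⟩

lemma isHookRemoval_partOfBeta {e : ℕ} (he : 0 < e) {S : Finset ℕ} {x : ℕ}
    (hx : x ∈ movable e S) : IsHookRemoval e (partOfBeta S) (partOfBeta (move e S x)) := by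
  have hx' := mem_movable.mp hx
  refine ⟨pos_of_mem_partOfBeta, pos_of_mem_partOfBeta, he, S.card, x, card_partOfBeta_le S, ?_,
    ?_⟩
  · rw [← card_move hx]
    exact card_partOfBeta_le _
  · have h := betaSet_partOfBeta (move e S x)
    rw [card_move hx] at h
    rw [betaSet_partOfBeta, h]
    exact ⟨hx'.1, hx'.2.1, hx'.2.2, rfl⟩

lemma parity_betaSet {lam : Multiset ℕ} (h : OddP lam) {m : ℕ} (hm : Multiset.card lam ≤ m) :
    parity (betaSet lam m) = 1 := by
  rwa [← oddP_partOfBeta, partOfBeta_betaSet h.1 hm]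

lemma IsHookRemoval.unique {k : ℕ} {lam mu nu : Multiset ℕ} (hl : OddP lam)
    (h1 : IsHookRemoval (2 ^ k) lam mu) (hmu : OddP mu)
    (h2 : IsHookRemoval (2 ^ k) lam nu) (hnu : OddP nu) : mu = nu := by
  obtain ⟨m, hm1, hm2, hm⟩ := h1.exists_move
  obtain ⟨n, hn1, hn2, hn⟩ := h2.exists_move
  obtain ⟨x, hx, hxm⟩ := hm (max m n) (le_max_left _ _)
  obtain ⟨y, hy, hym⟩ := hn (max m n) (le_max_right _ _)
  have hx' : x ∈ oddMoves k (betaSet lam (max m n)) := by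
    rw [mem_oddMoves, ← hxm]
    exact ⟨hx, parity_betaSet hmu (hm2.trans (le_max_left _ _))⟩
  have hy' : y ∈ oddMoves k (betaSet lam (max m n)) := by
    rw [mem_oddMoves, ← hym]
    exact ⟨hy, parity_betaSet hnu (hn2.trans (le_max_right _ _))⟩
  have hxy := oddMoves_unique k (parity_betaSet hl (hm1.trans (le_max_left _ _))) hx' hy'
  rw [← partOfBeta_betaSet hmu.1 (hm2.trans (le_max_left m n)), hxm, hxy, ← hym,
    partOfBeta_betaSet hnu.1 (hn2.trans (le_max_right m n))]

lemma fkOp_partOfBeta {k : ℕ} {S : Finset ℕ} (hS : parity S = 1) {x : ℕ}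
    (hx : x ∈ oddMoves k S) : fkOp k (partOfBeta S) = partOfBeta (move (2 ^ k) S x) := by
  rw [mem_oddMoves] at hx
  have h1 := isHookRemoval_partOfBeta (by positivity) hx.1
  have h2 := oddP_partOfBeta.mpr hx.2
  have h : ∃ mu, IsHookRemoval (2 ^ k) (partOfBeta S) mu ∧ OddP mu := ⟨_, h1, h2⟩
  rw [fkOp, dif_pos h]
  exact IsHookRemoval.unique (oddP_partOfBeta.mpr hS) h.choose_spec.1 h.choose_spec.2 h1 h2

lemma exists_oddMoves {k : ℕ} {S : Finset ℕ} (hS : parity S = 1) (h : 2 ^ k ≤ bsize S) :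
    ∃ x, x ∈ oddMoves k S :=
  Finset.card_pos.mp (odd_card_oddMoves hS h).pos

lemma exists_partOfBeta {lam : Multiset ℕ} (h : OddP lam) :
    ∃ S, Even S.card ∧ parity S = 1 ∧ partOfBeta S = lam := by
  refine ⟨betaSet lam (2 * Multiset.card lam), ?_, parity_betaSet h (by omega),
    partOfBeta_betaSet h.1 (by omega)⟩
  rw [card_betaSet]
  exact even_two_mul _

lemma fkOp_spec {k : ℕ} {lam : Multiset ℕ} (hl : OddP lam) (h : 2 ^ k ≤ lam.sum) :
    OddP (fkOp k lam) ∧ (fkOp k lam).sum + 2 ^ k = lam.sum := by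
  obtain ⟨S, -, hS, rfl⟩ := exists_partOfBeta hl
  obtain ⟨x, hx⟩ := exists_oddMoves hS h
  rw [fkOp_partOfBeta hS hx]
  rw [mem_oddMoves] at hx
  exact ⟨oddP_partOfBeta.mpr hx.2, bsize_move hx.1⟩

/-! ### Runners of the 2-abacus -/

/-- The runner of the 2-abacus consisting of the beads congruent to `i`. -/
def run (i : ℕ) (S : Finset ℕ) : Finset ℕ := (S.filter (fun b => b % 2 = i)).image (fun b => b / 2)

lemma mem_run {i : ℕ} (hi : i < 2) {S : Finset ℕ} {y : ℕ} : y ∈ run i S ↔ 2 * y + i ∈ S := by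
  simp only [run, Finset.mem_image, Finset.mem_filter]
  constructor
  · rintro ⟨b, ⟨hb, hbi⟩, rfl⟩
    rwa [show 2 * (b / 2) + i = b by omega]
  · intro h
    exact ⟨_, ⟨h, by omega⟩, by omega⟩

lemma run_ext {S T : Finset ℕ} (h : ∀ i < 2, run i S = run i T) : S = T := by
  ext a
  have hi : a % 2 < 2 := Nat.mod_lt _ (by norm_num)
  rw [← Nat.div_add_mod a 2, ← mem_run hi, ← mem_run hi, h _ hi]

lemma mem_movable_run {e i : ℕ} (hi : i < 2) {S : Finset ℕ} {y : ℕ} :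
    y ∈ movable e (run i S) ↔ 2 * y + i ∈ movable (2 * e) S := by
  rw [mem_movable, mem_movable, mem_run hi, mem_run hi]
  constructor
  · rintro ⟨h1, h2, h3⟩
    rw [show 2 * (y - e) + i = 2 * y + i - 2 * e by omega] at h3
    exact ⟨h1, by omega, h3⟩
  · rintro ⟨h1, h2, h3⟩
    rw [show 2 * y + i - 2 * e = 2 * (y - e) + i by omega] at h3
    exact ⟨h1, by omega, h3⟩

lemma run_move_same {e i : ℕ} (hi : i < 2) {S : Finset ℕ} {y : ℕ} (hy : y ∈ movable e (run i S)) :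
    run i (move (2 * e) S (2 * y + i)) = move e (run i S) y := by
  have hy' := mem_movable.mp hy
  ext a
  rw [mem_run hi, mem_move, mem_move, mem_run hi]
  constructor
  · rintro (h | h)
    · exact Or.inl (by omega)
    · exact Or.inr ⟨by omega, h.2⟩
  · rintro (h | h)
    · exact Or.inl (by omega)
    · exact Or.inr ⟨by omega, h.2⟩

lemma run_move_other {e i j : ℕ} (hi : i < 2) (hj : j < 2) (hij : i ≠ j) {S : Finset ℕ} {y : ℕ}
    (hy : y ∈ movable e (run i S)) : run j (move (2 * e) S (2 * y + i)) = run j S := by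
  have hy' := mem_movable.mp hy
  ext a
  rw [mem_run hj, mem_move, mem_run hj]
  constructor
  · rintro (h | h)
    · omega
    · exact h.2
  · intro h
    exact Or.inr ⟨by omega, h⟩

lemma run_shift_shift {i : ℕ} (hi : i < 2) (S : Finset ℕ) :
    run i (shift (shift S)) = shift (run i S) := by
  ext a
  simp only [mem_run hi, mem_shift]
  constructor
  · rintro (h | ⟨b, rfl | ⟨c, hc, rfl⟩, h⟩)
    · exact Or.inl (by omega)
    · exact Or.inl (by omega)
    · by_cases ha : a = 0
      · exact Or.inl ha
      · refine Or.inr ⟨a - 1, ?_, by omega⟩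
        rwa [show 2 * (a - 1) + i = c by omega]
  · rintro (rfl | ⟨b, hb, rfl⟩)
    · by_cases h0 : i = 0
      · exact Or.inl (by omega)
      · exact Or.inr ⟨0, Or.inl rfl, by omega⟩
    · exact Or.inr ⟨_, Or.inr ⟨_, hb, rfl⟩, by omega⟩

lemma partOfBeta_run_betaSet {i : ℕ} (hi : i < 2) {lam : Multiset ℕ} {m : ℕ}
    (hm : Multiset.card lam ≤ m) (N : ℕ) :
    partOfBeta (run i (betaSet lam (m + 2 * N))) = partOfBeta (run i (betaSet lam m)) := by
  induction N with
  | zero => rfl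
  | succ N ih =>
    rw [← ih, show m + 2 * (N + 1) = m + 2 * N + 1 + 1 by ring, betaSet_succ (by omega),
      betaSet_succ (by omega), run_shift_shift hi, partOfBeta_shift]

lemma quot2_partOfBeta {S : Finset ℕ} (hS : Even S.card) :
    quot2 (partOfBeta S) = (partOfBeta (run 0 S), partOfBeta (run 1 S)) := by
  have key : ∀ i < 2, partOfBeta (run i (betaSet (partOfBeta S)
      (2 * Multiset.card (partOfBeta S)))) = partOfBeta (run i S) := by
    intro i hi
    obtain ⟨N, hN⟩ := hS
    conv_rhs => rw [← betaSet_partOfBeta S]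
    rw [← partOfBeta_run_betaSet hi (by omega) N,
      ← partOfBeta_run_betaSet hi (card_partOfBeta_le S) (Multiset.card (partOfBeta S)),
      show S.card + 2 * Multiset.card (partOfBeta S) =
        2 * Multiset.card (partOfBeta S) + 2 * N by omega]
  exact Prod.ext (key 0 (by norm_num)) (key 1 (by norm_num))

lemma bsize_run_le (S : Finset ℕ) : 2 * (bsize (run 0 S) + bsize (run 1 S)) ≤ bsize S := by
  induction hn : bsize S using Nat.strong_induction_on generalizing S with
  | _ n ih =>
  subst hn
  have key : ∀ i < 2, ∀ j < 2, i ≠ j → bsize (run i S) ≠ 0 →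
      2 * (bsize (run i S) + bsize (run j S)) ≤ bsize S := by
    intro i hi j hj hij h0
    obtain ⟨p, hp⟩ : ∃ p, p ∈ partOfBeta (run i S) := by
      refine Multiset.exists_mem_of_ne_zero fun h => h0 ?_
      rw [bsize, h, Multiset.sum_zero]
    obtain ⟨y, hy, -⟩ := exists_movable_beadPart hp
    have h1 := bsize_move hy
    have h2 := bsize_move ((mem_movable_run hi).mp hy)
    have h3 := ih (bsize (move (2 * 1) S (2 * y + i))) (by omega) _ rfl
    have h4 : bsize (run i (move (2 * 1) S (2 * y + i))) +
        bsize (run j (move (2 * 1) S (2 * y + i))) =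
        bsize (run 0 (move (2 * 1) S (2 * y + i))) +
        bsize (run 1 (move (2 * 1) S (2 * y + i))) := by
      obtain ⟨rfl, rfl⟩ | ⟨rfl, rfl⟩ : i = 0 ∧ j = 1 ∨ i = 1 ∧ j = 0 := by omega
      · rfl
      · exact add_comm _ _
    rw [← h4, run_move_same hi hy, run_move_other hi hj hij hy] at h3
    omega
  by_cases h0 : bsize (run 0 S) = 0
  · by_cases h1 : bsize (run 1 S) = 0
    · omega
    · have := key 1 (by norm_num) 0 (by norm_num) (by norm_num) h1
      omega
  · exact key 0 (by norm_num) 1 (by norm_num) (by norm_num) h0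

lemma bsize_run_add_le {i j : ℕ} (hi : i < 2) (hj : j < 2) (hij : i ≠ j) (S : Finset ℕ) :
    2 * (bsize (run i S) + bsize (run j S)) ≤ bsize S := by
  have := bsize_run_le S
  obtain ⟨rfl, rfl⟩ | ⟨rfl, rfl⟩ : i = 0 ∧ j = 1 ∨ i = 1 ∧ j = 0 := by omega
  · exact this
  · rwa [add_comm]

lemma parity_of_bsize_eq_zero {S : Finset ℕ} (h : bsize S = 0) : parity S = 1 := by
  have h0 : partOfBeta S = 0 := by
    refine Multiset.eq_zero_of_forall_notMem fun p hp => ?_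
    have h1 := Multiset.single_le_sum (fun _ _ => Nat.zero_le _) p hp
    have h2 := pos_of_mem_partOfBeta p hp
    rw [bsize] at h
    omega
  rw [parity, h0, degSYT, dif_pos rfl, Nat.cast_one]

lemma testBit_two_pow_add {s a : ℕ} (ha : a < 2 ^ s) (b : ℕ) :
    (2 ^ s + a).testBit b = (decide (s = b) || a.testBit b) := by
  have h := Nat.two_pow_add_eq_or_of_lt ha 1
  rw [mul_one] at h
  rw [h, Nat.testBit_or, Nat.testBit_two_pow]

lemma exists_move_run {k : ℕ} {S : Finset ℕ} {x : ℕ} (hx : x ∈ movable (2 ^ (k + 1)) S) :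
    ∃ i < 2, ∃ j < 2, i ≠ j ∧ ∃ y ∈ movable (2 ^ k) (run i S),
      run i (move (2 ^ (k + 1)) S x) = move (2 ^ k) (run i S) y ∧
      run j (move (2 ^ (k + 1)) S x) = run j S := by
  rw [pow_succ'] at hx ⊢
  have hi : x % 2 < 2 := Nat.mod_lt _ (by norm_num)
  have hx2 : 2 * (x / 2) + x % 2 = x := Nat.div_add_mod x 2
  have hy : x / 2 ∈ movable (2 ^ k) (run (x % 2) S) := by
    rw [mem_movable_run hi, hx2]
    exact hx
  refine ⟨x % 2, hi, 1 - x % 2, by omega, by omega, x / 2, hy, ?_, ?_⟩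
  · have := run_move_same hi hy
    rwa [hx2] at this
  · have := run_move_other hi (show 1 - x % 2 < 2 by omega) (by omega) hy
    rwa [hx2] at this

/-- The partitions in the 2-quotient of an odd partition are odd, and the binary digits of their
sizes are distributed among those of the size of the partition. -/
lemma run_of_parity_eq_one {S : Finset ℕ} (hS : parity S = 1) :
    (∀ i < 2, parity (run i S) = 1) ∧
    (∀ i < 2, ∀ j < 2, i ≠ j → ∀ b, (bsize (run i S)).testBit b = true →
      (bsize (run j S)).testBit b = false) ∧
    (∀ i < 2, ∀ b, (bsize (run i S)).testBit b = true → (bsize S).testBit (b + 1) = true) := by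
  induction hn : bsize S using Nat.strong_induction_on generalizing S with
  | _ n ih =>
  subst hn
  have hle := bsize_run_le S
  by_cases hsmall : bsize S ≤ 1
  · have h0 : ∀ i < 2, bsize (run i S) = 0 := by
      intro i hi
      obtain rfl | rfl : i = 0 ∨ i = 1 := by omega
      · omega
      · omega
    refine ⟨fun i hi => parity_of_bsize_eq_zero (h0 i hi), fun i hi j hj _ b hb => ?_,
      fun i hi b hb => ?_⟩
    · rw [h0 i hi, Nat.zero_testBit] at hb
      exact absurd hb (by decide)
    · rw [h0 i hi, Nat.zero_testBit] at hb
      exact absurd hb (by decide)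
  obtain ⟨t, ht1, ht2⟩ : ∃ t, 2 ^ (t + 1) ≤ bsize S ∧ bsize S < 2 ^ (t + 2) := by
    have h1 := Nat.pow_log_le_self 2 (show bsize S ≠ 0 by omega)
    have h2 := Nat.lt_pow_succ_log_self (show 1 < 2 by norm_num) (bsize S)
    have h3 : Nat.log 2 (bsize S) ≠ 0 := fun h => by
      rw [h] at h2
      omega
    refine ⟨Nat.log 2 (bsize S) - 1, ?_, ?_⟩
    · rwa [show Nat.log 2 (bsize S) - 1 + 1 = Nat.log 2 (bsize S) by omega]
    · rwa [show Nat.log 2 (bsize S) - 1 + 2 = Nat.log 2 (bsize S) + 1 by omega]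
  obtain ⟨x, hx⟩ := exists_oddMoves hS ht1
  rw [mem_oddMoves] at hx
  obtain ⟨hx, hxp⟩ := hx
  have hsz := bsize_move hx
  have hp : 0 < 2 ^ t := by positivity
  rw [show 2 ^ (t + 2) = 4 * 2 ^ t by ring] at ht2
  have h2t : 2 ^ (t + 1) = 2 * 2 ^ t := by ring
  obtain ⟨i, hi, j, hj, hij, y, hy, hri, hrj⟩ := exists_move_run hx
  obtain ⟨ih1, ih2, ih3⟩ := ih _ (by omega) hxp rfl
  have hle' := bsize_run_add_le hi hj hij (move (2 ^ (t + 1)) S x)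
  have hri' := bsize_move hy
  rw [← hri] at hri'
  have hcover : ∀ l < 2, l = i ∨ l = j := by
    intro l hl
    omega
  have hbi : ∀ b, (bsize (run i S)).testBit b =
      (decide (t = b) || (bsize (run i (move (2 ^ (t + 1)) S x))).testBit b) := by
    intro b
    rw [← hri', add_comm, testBit_two_pow_add (by omega)]
  have hbj : ∀ b, t = b → (bsize (run j S)).testBit b = false := by
    rintro b rfl
    rw [← hrj]
    exact Nat.testBit_lt_two_pow (by omega)
  have hbS : ∀ b, (bsize S).testBit b =
      (decide (t + 1 = b) || (bsize (move (2 ^ (t + 1)) S x)).testBit b) := by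
    intro b
    rw [← hsz, add_comm, testBit_two_pow_add (by omega)]
  refine ⟨fun l hl => ?_, fun l hl m hm hlm b hb => ?_, fun l hl b hb => ?_⟩
  · rcases hcover l hl with rfl | rfl
    · rw [← parity_move_top _ _ hy, ← hri]
      · exact ih1 _ hi
      · omega
      · omega
    · rw [← hrj]
      exact ih1 _ hj
  · rcases hcover l hl with rfl | rfl
    · obtain rfl : m = j := by
        have := hcover m hm
        tauto
      rw [hbi, Bool.or_eq_true, decide_eq_true_iff] at hb
      rcases hb with hb | hb
      · exact hbj b hb
      · rw [← hrj]
        exact ih2 _ hi _ hj hij b hb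
    · obtain rfl : m = i := by
        have := hcover m hm
        tauto
      have htb : t ≠ b := fun h => by
        rw [hbj b h] at hb
        exact absurd hb (by decide)
      rw [hbi, decide_eq_false htb, Bool.false_or]
      rw [← hrj] at hb
      exact ih2 _ hj _ hi hij.symm b hb
  · rw [hbS, Bool.or_eq_true, decide_eq_true_iff]
    rcases hcover l hl with rfl | rfl
    · rw [hbi, Bool.or_eq_true, decide_eq_true_iff] at hb
      rcases hb with hb | hb
      · exact Or.inl (by omega)
      · exact Or.inr (ih3 _ hi b hb)
    · rw [← hrj] at hb
      exact Or.inr (ih3 _ hj b hb)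

/-! ### The 2-quotient tower -/

lemma towerRow_succ (k : ℕ) (lam : Multiset ℕ) :
    towerRow (k + 1) lam = towerRow k (quot2 lam).1 ++ towerRow k (quot2 lam).2 := by
  induction k generalizing lam with
  | zero => rfl
  | succ k ih =>
    rw [towerRow, ih, List.flatMap_append]
    rfl

lemma length_towerRow (k : ℕ) (lam : Multiset ℕ) : (towerRow k lam).length = 2 ^ k := by
  induction k generalizing lam with
  | zero => rfl
  | succ k ih => rw [towerRow_succ, List.length_append, ih, ih, pow_succ, mul_two]

lemma towerRow_succ_partOfBeta (k : ℕ) {S : Finset ℕ} (hS : Even S.card) :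
    towerRow (k + 1) (partOfBeta S) =
      towerRow k (partOfBeta (run 0 S)) ++ towerRow k (partOfBeta (run 1 S)) := by
  rw [towerRow_succ, quot2_partOfBeta hS]

lemma testBit_of_mem_towerRow {k : ℕ} {lam : Multiset ℕ} (hl : OddP lam) {c : Multiset ℕ}
    (hc : c ∈ towerRow k lam) {b : ℕ} (hb : c.sum.testBit b = true) :
    lam.sum.testBit (b + k) = true := by
  induction k generalizing lam with
  | zero =>
    obtain rfl : c = lam := by simpa [towerRow] using hc
    exact hb
  | succ k ih =>
    obtain ⟨S, hS2, hS, rfl⟩ := exists_partOfBeta hl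
    obtain ⟨h1, -, h3⟩ := run_of_parity_eq_one hS
    rw [towerRow_succ_partOfBeta k hS2, List.mem_append] at hc
    rcases hc with hc | hc
    · exact h3 0 (by norm_num) _ (ih (oddP_partOfBeta.mpr (h1 0 (by norm_num))) hc)
    · exact h3 1 (by norm_num) _ (ih (oddP_partOfBeta.mpr (h1 1 (by norm_num))) hc)

lemma ne_of_mem_towerRow_run {k : ℕ} {S : Finset ℕ} (hS : parity S = 1) {i j : ℕ} (hi : i < 2)
    (hj : j < 2) (hij : i ≠ j) {c d : Multiset ℕ} (hc : c ∈ towerRow k (partOfBeta (run i S)))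
    (hd : d ∈ towerRow k (partOfBeta (run j S))) (hpos : 0 < c.sum) : c ≠ d := by
  rintro rfl
  obtain ⟨b, hb⟩ := Nat.exists_testBit_of_ne_zero hpos.ne'
  obtain ⟨h1, h2, -⟩ := run_of_parity_eq_one hS
  have hbi := testBit_of_mem_towerRow (oddP_partOfBeta.mpr (h1 i hi)) hc hb
  have hbj := testBit_of_mem_towerRow (oddP_partOfBeta.mpr (h1 j hj)) hd hb
  have := h2 i hi j hj hij _ hbi
  rw [bsize, hbj] at this
  exact absurd this (by decide)

/-- `T` is obtained from `S` by an odd `2 ^ (k + 1)`-hook removal acting on runner `i`. -/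
structure RunMove (k : ℕ) (S T : Finset ℕ) (i j : ℕ) : Prop where
  left_lt : i < 2
  right_lt : j < 2
  ne : i ≠ j
  card_eq : T.card = S.card
  parity_eq : parity T = 1
  fkOp_eq : fkOp (k + 1) (partOfBeta S) = partOfBeta T
  card_run : (run i T).card = (run i S).card
  run_other : run j T = run j S
  run_fkOp : partOfBeta (run i T) = fkOp k (partOfBeta (run i S))
  le_bsize : 2 ^ k ≤ bsize (run i S)
  bsize_add : bsize (run i T) + 2 ^ k = bsize (run i S)

lemma exists_runMove {k : ℕ} {S : Finset ℕ} (hS : parity S = 1) (h : 2 ^ (k + 1) ≤ bsize S) :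
    ∃ T i j, RunMove k S T i j := by
  obtain ⟨x, hx⟩ := exists_oddMoves hS h
  have hf := fkOp_partOfBeta hS hx
  rw [mem_oddMoves] at hx
  obtain ⟨i, hi, j, hj, hij, y, hy, hri, hrj⟩ := exists_move_run hx.1
  have hsz := bsize_move hy
  have hodd := (run_of_parity_eq_one hx.2).1 i hi
  rw [hri] at hodd
  have hfr := fkOp_partOfBeta ((run_of_parity_eq_one hS).1 i hi) (mem_oddMoves.mpr ⟨hy, hodd⟩)
  refine ⟨move (2 ^ (k + 1)) S x, i, j, hi, hj, hij, card_move hx.1, hx.2, hf, ?_, hrj, ?_, ?_, ?_⟩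
  · rw [hri, card_move hy]
  · rw [hri, hfr]
  · omega
  · rw [hri, hsz]

lemma fkOp_of_run {k i j : ℕ} (hi : i < 2) (hj : j < 2) (hij : i ≠ j) {A B : Finset ℕ}
    (hA : parity A = 1) (hB : parity B = 1) (hc : (run i B).card = (run i A).card)
    (hj' : run j B = run j A) (hle : 2 ^ k ≤ bsize (run i A))
    (hf : partOfBeta (run i B) = fkOp k (partOfBeta (run i A))) :
    fkOp (k + 1) (partOfBeta A) = partOfBeta B := by
  have hrA := (run_of_parity_eq_one hA).1 i hi
  obtain ⟨y, hy⟩ := exists_oddMoves hrA hle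
  rw [fkOp_partOfBeta hrA hy] at hf
  rw [mem_oddMoves] at hy
  have hrun : run i B = move (2 ^ k) (run i A) y :=
    partOfBeta_injOn (by rw [hc, card_move hy.1]) hf
  have hBA : B = move (2 ^ (k + 1)) A (2 * y + i) := by
    refine run_ext fun l hl => ?_
    rw [pow_succ']
    obtain rfl | rfl : l = i ∨ l = j := by omega
    · rw [hrun, run_move_same hi hy.1]
    · rw [hj', run_move_other hi hj hij hy.1]
  rw [hBA] at hB ⊢
  refine fkOp_partOfBeta hA (mem_oddMoves.mpr ⟨?_, hB⟩)
  rw [pow_succ', ← mem_movable_run hi]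
  exact hy.1

/-- `c` is the component of row `k` changed in the passage from `lam` to `fkOp j lam`. -/
def IsChanged (k j : ℕ) (lam c : Multiset ℕ) : Prop :=
  ∃ s < 2 ^ k, (towerRow k lam).getD s 0 = c ∧
    towerRow k (fkOp j lam) = (towerRow k lam).set s (fkOp (j - k) c)

lemma IsChanged.mem {k j : ℕ} {lam c : Multiset ℕ} (h : IsChanged k j lam c) :
    c ∈ towerRow k lam := by
  obtain ⟨s, hs, rfl, -⟩ := h
  rw [← length_towerRow k lam] at hs
  rw [List.getD_eq_getElem _ _ hs]
  exact List.getElem_mem hs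

lemma IsChanged.rcomp_eq {k j : ℕ} {lam c : Multiset ℕ} (h : IsChanged k j lam c)
    (hne : fkOp (j - k) c ≠ c) : Rcomp k j lam = c := by
  obtain ⟨s, hs, rfl, hset⟩ := h
  have hex : ∃ s, s < 2 ^ k ∧ towerRow k (fkOp j lam) =
      (towerRow k lam).set s (fkOp (j - k) ((towerRow k lam).getD s 0)) := ⟨s, hs, hset⟩
  rw [Rcomp, dif_pos hex]
  have h2 := hex.choose_spec.2
  generalize hex.choose = r at h2
  by_contra hr
  have hrs : r ≠ s := fun h => hr (by rw [h])
  have hs' : s < (towerRow k lam).length := by rwa [length_towerRow]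
  have h3 : ((towerRow k lam).set s (fkOp (j - k) ((towerRow k lam).getD s 0)))[s]? =
      (towerRow k lam)[s]? := by
    rw [← hset, h2, List.getElem?_set_ne hrs]
  rw [List.getElem?_set_self hs', List.getElem?_eq_getElem hs',
    Option.some_inj, ← List.getD_eq_getElem _ 0 hs'] at h3
  exact hne h3

lemma isChanged_zero (j : ℕ) (lam : Multiset ℕ) : IsChanged 0 j lam lam :=
  ⟨0, by norm_num, rfl, rfl⟩

lemma RunMove.isChanged {k j : ℕ} {S T : Finset ℕ} {i i' : ℕ} (h : RunMove j S T i i')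
    (hS : Even S.card) {c : Multiset ℕ} (hc : IsChanged k j (partOfBeta (run i S)) c) :
    IsChanged (k + 1) (j + 1) (partOfBeta S) c := by
  obtain ⟨s, hs, rfl, hset⟩ := hc
  have hT : Even T.card := by rwa [h.card_eq]
  rw [← h.run_fkOp] at hset
  have h1 := h.left_lt
  have h2 := h.right_lt
  have h3 := h.ne
  have h4 := h.run_other
  have h5 := h.fkOp_eq
  obtain ⟨rfl, rfl⟩ | ⟨rfl, rfl⟩ : i = 0 ∧ i' = 1 ∨ i = 1 ∧ i' = 0 := by omega
  · refine ⟨s, by rw [pow_succ]; omega, ?_, ?_⟩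
    · rw [towerRow_succ_partOfBeta k hS, List.getD_append _ _ _ _ (by rwa [length_towerRow])]
    · rw [h5, towerRow_succ_partOfBeta k hT, towerRow_succ_partOfBeta k hS, h4, hset,
        List.set_append_left _ _ (by rwa [length_towerRow]), Nat.add_sub_add_right]
  · refine ⟨2 ^ k + s, by rw [pow_succ]; omega, ?_, ?_⟩
    · rw [towerRow_succ_partOfBeta k hS, List.getD_append_right _ _ _ _
        (by rw [length_towerRow]; omega), length_towerRow, Nat.add_sub_cancel_left]
    · rw [h5, towerRow_succ_partOfBeta k hT, towerRow_succ_partOfBeta k hS, h4, hset,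
        List.set_append_right _ _ (by rw [length_towerRow]; omega), length_towerRow,
        Nat.add_sub_cancel_left, Nat.add_sub_add_right]

lemma exists_isChanged {k j : ℕ} (hkj : k ≤ j) {lam : Multiset ℕ} (hl : OddP lam)
    (h : 2 ^ j ≤ lam.sum) : ∃ c, IsChanged k j lam c ∧ OddP c ∧ 2 ^ (j - k) ≤ c.sum := by
  induction k generalizing j lam with
  | zero => exact ⟨lam, isChanged_zero j lam, hl, h⟩
  | succ k ih =>
    obtain ⟨j, rfl⟩ : ∃ l, j = l + 1 := ⟨j - 1, by omega⟩
    obtain ⟨S, hS2, hS, rfl⟩ := exists_partOfBeta hl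
    obtain ⟨T, i, i', hT⟩ := exists_runMove hS h
    obtain ⟨c, hc, hco, hcs⟩ := ih (by omega)
      (oddP_partOfBeta.mpr ((run_of_parity_eq_one hS).1 i hT.left_lt)) hT.le_bsize
    exact ⟨c, hT.isChanged hS2 hc, hco, by rwa [Nat.add_sub_add_right]⟩

lemma fkOp_ne {k : ℕ} {lam : Multiset ℕ} (hl : OddP lam) (h : 2 ^ k ≤ lam.sum) :
    fkOp k lam ≠ lam := by
  intro h'
  have h1 := (fkOp_spec hl h).2
  have h2 : 0 < 2 ^ k := by positivity
  rw [h'] at h1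
  omega

lemma rcomp_spec {k j : ℕ} (hkj : k ≤ j) {lam : Multiset ℕ} (hl : OddP lam)
    (h : 2 ^ j ≤ lam.sum) : IsChanged k j lam (Rcomp k j lam) ∧ OddP (Rcomp k j lam) ∧
      2 ^ (j - k) ≤ (Rcomp k j lam).sum := by
  obtain ⟨c, h1, h2, h3⟩ := exists_isChanged hkj hl h
  rw [h1.rcomp_eq (fkOp_ne h2 h3)]
  exact ⟨h1, h2, h3⟩

lemma RunMove.rcomp_eq {k j : ℕ} (hkj : k ≤ j) {S T : Finset ℕ} {i i' : ℕ}
    (h : RunMove j S T i i') (hS2 : Even S.card) (hS : parity S = 1) :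
    Rcomp (k + 1) (j + 1) (partOfBeta S) = Rcomp k j (partOfBeta (run i S)) := by
  obtain ⟨h1, h2, h3⟩ := rcomp_spec hkj
    (oddP_partOfBeta.mpr ((run_of_parity_eq_one hS).1 i h.left_lt)) h.le_bsize
  refine (h.isChanged hS2 h1).rcomp_eq ?_
  rw [Nat.add_sub_add_right]
  exact fkOp_ne h2 h3

lemma rcomp_zero {j : ℕ} {lam : Multiset ℕ} (hl : OddP lam) (h : 2 ^ j ≤ lam.sum) :
    Rcomp 0 j lam = lam :=
  (isChanged_zero j lam).rcomp_eq (fkOp_ne hl h)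

lemma RunMove.fkOp_fkOp_eq_iff {k : ℕ} {S T T' : Finset ℕ} {i j : ℕ}
    (h : RunMove k S T i j) (h' : RunMove (k + 1) S T' i j) :
    fkOp (k + 1) (partOfBeta T) = partOfBeta T' ↔
      fkOp k (partOfBeta (run i T)) = partOfBeta (run i T') := by
  have hp : 2 ^ (k + 1) = 2 * 2 ^ k := pow_succ' 2 k
  have hle := h'.le_bsize
  have hadd := h.bsize_add
  constructor
  · intro heq
    have hbT : 2 ^ (k + 1) ≤ bsize T := by
      have := bsize_run_add_le h.left_lt h.right_lt h.ne T
      omega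
    obtain ⟨U, l, m, hU⟩ := exists_runMove h.parity_eq hbT
    have hUT : U = T' := by
      refine partOfBeta_injOn ?_ (by rw [← hU.fkOp_eq, heq])
      rw [hU.card_eq, h.card_eq, h'.card_eq]
    subst hUT
    have hl := hU.left_lt
    have hi := h.left_lt
    have hj := h.right_lt
    have hij := h.ne
    obtain rfl | rfl : l = i ∨ l = j := by omega
    · exact hU.run_fkOp.symm
    · have h1 := hU.bsize_add
      rw [h'.run_other, ← h.run_other] at h1
      have : 0 < 2 ^ k := by positivity
      omega
  · intro heq
    refine fkOp_of_run h.left_lt h.right_lt h.ne h.parity_eq h'.parity_eq ?_ ?_ ?_ heq.symm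
    · rw [h.card_run, h'.card_run]
    · rw [h.run_other, h'.run_other]
    · omega

lemma RunMove.fkOp_fkOp_ne {k : ℕ} {S T T' : Finset ℕ} {i j : ℕ} (hb : 2 ^ (k + 2) ≤ bsize S)
    (hbT : bsize T + 2 ^ (k + 1) = bsize S)
    (h : RunMove k S T i j) (h' : RunMove (k + 1) S T' j i) :
    fkOp (k + 1) (partOfBeta T) ≠ partOfBeta T' := by
  intro heq
  have hp : 0 < 2 ^ k := by positivity
  have hp1 : 2 ^ (k + 1) = 2 * 2 ^ k := pow_succ' 2 k
  have hp2 : 2 ^ (k + 2) = 2 * 2 ^ (k + 1) := pow_succ' 2 (k + 1)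
  obtain ⟨U, l, m, hU⟩ := exists_runMove h.parity_eq (k := k) (by omega)
  have hUT : U = T' := by
    refine partOfBeta_injOn ?_ (by rw [← hU.fkOp_eq, heq])
    rw [hU.card_eq, h.card_eq, h'.card_eq]
  subst hUT
  have hl := hU.left_lt
  have hm := hU.right_lt
  have hlm := hU.ne
  have hi := h.left_lt
  have hj := h.right_lt
  have hadd := h.bsize_add
  obtain rfl | rfl : i = l ∨ i = m := by omega
  · have h1 := hU.bsize_add
    rw [h'.run_other] at h1
    omega
  · rw [← hU.run_other, h'.run_other] at hadd
    omega

lemma fkOp_fkOp_eq_iff (k : ℕ) {lam : Multiset ℕ} (hl : OddP lam) (h : 2 ^ (k + 1) ≤ lam.sum) :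
    fkOp k (fkOp k lam) = fkOp (k + 1) lam ↔
      (Rcomp k k lam = Rcomp k (k + 1) lam ∧
        fkOp 0 (fkOp 0 (Rcomp k k lam)) = fkOp 1 (Rcomp k k lam)) := by
  induction k generalizing lam with
  | zero =>
    rw [rcomp_zero hl h, rcomp_zero hl (by norm_num at h ⊢; omega)]
    simp
  | succ k ih =>
    obtain ⟨S, hS2, hS, rfl⟩ := exists_partOfBeta hl
    have hb : 2 ^ (k + 2) ≤ bsize S := h
    obtain ⟨T, i, j, hT⟩ := exists_runMove hS (k := k)
      (le_trans (Nat.pow_le_pow_right (by norm_num) (by omega)) hb)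
    obtain ⟨T', i', j', hT'⟩ := exists_runMove hS hb
    have hoi := oddP_partOfBeta.mpr ((run_of_parity_eq_one hS).1 i hT.left_lt)
    have hoi' := oddP_partOfBeta.mpr ((run_of_parity_eq_one hS).1 i' hT'.left_lt)
    rw [hT.rcomp_eq le_rfl hS2 hS, hT'.rcomp_eq (Nat.le_succ k) hS2 hS, hT.fkOp_eq, hT'.fkOp_eq]
    have h1 := hT.left_lt
    have h2 := hT.right_lt
    have h3 := hT.ne
    have h1' := hT'.left_lt
    have h2' := hT'.right_lt
    have h3' := hT'.ne
    obtain ⟨rfl, rfl⟩ | ⟨rfl, rfl⟩ : i' = i ∧ j' = j ∨ i' = j ∧ j' = i := by omega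
    · rw [← ih hoi hT'.le_bsize, hT.fkOp_fkOp_eq_iff hT', hT.run_fkOp, hT'.run_fkOp]
    · have hbT : bsize T + 2 ^ (k + 1) = bsize S := by
        have hp : 2 ^ (k + 1) ≤ (partOfBeta S).sum :=
          le_trans (Nat.pow_le_pow_right (by norm_num) (by omega)) h
        have := (fkOp_spec hl hp).2
        rw [hT.fkOp_eq] at this
        exact this
      have hc := rcomp_spec le_rfl hoi hT.le_bsize
      have hc' := rcomp_spec (Nat.le_succ k) hoi' hT'.le_bsize
      have hne := ne_of_mem_towerRow_run hS h1 h2 h3 hc.1.mem hc'.1.mem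
        (lt_of_lt_of_le (by positivity) hc.2.2)
      exact iff_of_false (hT.fkOp_fkOp_ne hb hbT hT') fun h => hne h.1

theorem stmt5 (k n : ℕ) (h : 2 ^ (k + 1) ≤ n) (lam : Multiset ℕ)
    (hodd : OddP lam) (hsum : lam.sum = n) :
    fkOp k (fkOp k lam) = fkOp (k + 1) lam ↔
      (Rcomp k k lam = Rcomp k (k + 1) lam ∧
        fkOp 0 (fkOp 0 (Rcomp k k lam)) = fkOp 1 (Rcomp k k lam)) := by
  subst hsum
  exact fkOp_fkOp_eq_iff k hodd h

end OddSym
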